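/- Let X be a countable set and let P be given by a matrix of non-negative entries p(x,y) ≥ 0 with sup_{x∈X} Σ_{y∈X} p(x,y) < ∞, acting on ℓ∞(X) by (Pf)(x) = Σ_{y∈X} p(x,y) f(y). Then P : ℓ∞(X) → ℓ∞(X) is a compact operator if and only if for every ε > 0 there exists a finite subset A_ε ⊂ X such that sup_{x∈X} Σ_{y∈X∖A_ε} p(x,y) < ε. -/

import Mathlib

open scoped Classical ENNReal

noncomputable section

/-- Tail sums: the sum outside a finite set. -/
theorem tail_summable {X : Type*} {q : X → ℝ} (hq : Summable q) (A : Finset X) :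
    Summable (fun y => if y ∈ A then 0 else q y) := by
  have h := hq.indicator {y | y ∉ A}
  refine h.congr fun y => ?_
  by_cases hy : y ∈ A <;> simp [hy]

theorem tail_tsum {X : Type*} {q : X → ℝ} (hq : Summable q) (A : Finset X) :
    ∑' y, (if y ∈ A then 0 else q y) = ∑' y, q y - ∑ y ∈ A, q y := by
  have h1 : HasSum (fun y => if y ∈ A then q y else 0) (∑ y ∈ A, q y) := by
    have := hasSum_sum_of_ne_finset_zero (L := SummationFilter.unconditional X)
      (f := fun y => if y ∈ A then q y else 0) (s := A)
      (fun y hy => by simp [hy])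
    rwa [Finset.sum_congr rfl (g := q) (fun y hy => by simp [hy])] at this
  have h2 := hq.hasSum.sub h1
  rw [← h2.tsum_eq]
  refine tsum_congr fun y => ?_
  by_cases hy : y ∈ A <;> simp [hy]

theorem tail_tendsto {X : Type*} {q : X → ℝ} (hq : Summable q) :
    Filter.Tendsto (fun A : Finset X => ∑' y, (if y ∈ A then 0 else q y))
      Filter.atTop (nhds 0) := by
  simp_rw [tail_tsum hq]
  have h : Filter.Tendsto (fun A : Finset X => ∑ y ∈ A, q y) Filter.atTop (nhds (∑' y, q y)) :=
    hq.hasSum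
  simpa using h.const_sub (∑' y, q y)

/-- Evaluation at a point as a continuous functional on `ℓ∞`. -/
def evL {X : Type*} (x : X) : lp (fun _ : X => ℝ) ∞ →L[ℝ] ℝ :=
  LinearMap.mkContinuous
    { toFun := fun f => f x
      map_add' := fun _ _ => rfl
      map_smul' := fun _ _ => rfl } 1
    (fun f => by rw [one_mul]; exact lp.norm_apply_le_norm ENNReal.top_ne_zero f x)

theorem evL_apply {X : Type*} (x : X) (f : lp (fun _ : X => ℝ) ∞) : evL x f = f x := rfl

theorem finite_rank_compact {X : Type*} (v : X → lp (fun _ : X => ℝ) ∞) (A : Finset X) :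
    IsCompactOperator (∑ y ∈ A, (evL y).smulRight (v y) :
      lp (fun _ : X => ℝ) ∞ →L[ℝ] lp (fun _ : X => ℝ) ∞) := by
  induction A using Finset.induction_on with
  | empty => simpa using isCompactOperator_zero
  | insert a s ha ih =>
    rw [Finset.sum_insert ha]
    have h1 : IsCompactOperator ((evL a).smulRight (v a)) := by
      have h := isCompactOperator_of_locallyCompactSpace_dom (evL a)
      exact h.continuous_comp (g := fun t : ℝ => t • v a) (by fun_prop)
    exact h1.add ih

/-- The indicator function of the complement of `A`. -/
def coInd {X : Type*} (A : Finset X) : lp (fun _ : X => ℝ) ∞ :=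
  ⟨fun y => if y ∈ A then 0 else 1, memℓp_infty ⟨1, by
    rintro _ ⟨y, rfl⟩
    by_cases hy : y ∈ A <;> simp [hy]⟩⟩

theorem coInd_apply {X : Type*} (A : Finset X) (y : X) :
    coInd A y = if y ∈ A then 0 else 1 := rfl

theorem coInd_norm {X : Type*} (A : Finset X) : ‖coInd A‖ ≤ 1 := by
  refine lp.norm_le_of_forall_le zero_le_one fun y => ?_
  rw [coInd_apply]
  by_cases hy : y ∈ A <;> simp [hy]

/-- the Markov operator on `ℓ∞(X)` is compact iff for every `ε > 0` there is a
finite set `A` with `sup_x ∑_{y ∉ A} p(x,y) < ε`. -/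
theorem markov_operator_compact_iff {X : Type*} [Countable X]
    (p : X → X → ℝ) (hpos : ∀ x y, 0 ≤ p x y)
    (hsum : ∀ x, Summable (p x)) (C : ℝ) (hC : ∀ x, ∑' y, p x y ≤ C)
    (T : lp (fun _ : X => ℝ) ∞ →L[ℝ] lp (fun _ : X => ℝ) ∞)
    (hT : ∀ (f : lp (fun _ : X => ℝ) ∞) (x : X), T f x = ∑' y, p x y * f y) :
    IsCompactOperator T ↔
      ∀ ε : ℝ, 0 < ε → ∃ A : Finset X, ∀ x, ∑' y, (if y ∈ A then 0 else p x y) < ε := by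
  constructor
  · intro hc ε hε
    obtain ⟨K, hK, hsub⟩ := IsCompactOperator.image_closedBall_subset_compact
      (f := (T : lp (fun _ : X => ℝ) ∞ →ₗ[ℝ] lp (fun _ : X => ℝ) ∞)) hc 1
    have hval : ∀ (A : Finset X) x, T (coInd A) x = ∑' y, (if y ∈ A then 0 else p x y) := by
      intro A x
      rw [hT]
      refine tsum_congr fun y => ?_
      rw [coInd_apply]
      by_cases hy : y ∈ A <;> simp [hy]
    have hmem : ∀ A : Finset X, T (coInd A) ∈ K := fun A =>
      hsub ⟨coInd A, by simpa using coInd_norm A, rfl⟩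
    obtain ⟨g, -, hg⟩ := hK.exists_mapClusterPt (f := Filter.atTop)
      (u := fun A : Finset X => T (coInd A)) (Filter.tendsto_principal.2 (Filter.Eventually.of_forall hmem))
    have hg0 : g = 0 := by
      ext x
      have h1 : MapClusterPt (evL x g) Filter.atTop
          (evL x ∘ fun A : Finset X => T (coInd A)) :=
        hg.continuousAt_comp (evL x).continuous.continuousAt
      have h2 : Filter.Tendsto (evL x ∘ fun A : Finset X => T (coInd A))
          Filter.atTop (nhds 0) := by
        refine (tail_tendsto (hsum x)).congr fun A => ?_
        simp only [Function.comp, evL_apply, hval]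
      have h3 : evL x g = 0 := eq_of_nhds_neBot (ClusterPt.mono h1 h2)
      simpa [evL_apply] using h3
    subst hg0
    have hfr := hg.frequently (Metric.ball_mem_nhds 0 hε)
    obtain ⟨A, hA⟩ := hfr.exists
    refine ⟨A, fun x => ?_⟩
    rw [← hval]
    have h4 := lp.norm_apply_le_norm ENNReal.top_ne_zero (T (coInd A)) x
    have h5 : ‖T (coInd A)‖ < ε := by simpa using hA
    exact (le_abs_self _).trans_lt (h4.trans_lt h5)
  · intro h
    have hcl := isClosed_setOfPred_isCompactOperator (σ₁₂ := RingHom.id ℝ)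
      (M₁ := lp (fun _ : X => ℝ) ∞) (M₂ := lp (fun _ : X => ℝ) ∞)
    have : T ∈ closure {f : lp (fun _ : X => ℝ) ∞ →L[ℝ] lp (fun _ : X => ℝ) ∞ |
        IsCompactOperator f} := by
      rw [Metric.mem_closure_iff]
      intro ε hε
      obtain ⟨A, hA⟩ := h (ε / 2) (half_pos hε)
      refine ⟨_, finite_rank_compact (fun y => T (lp.single ∞ y 1)) A, ?_⟩
      rw [dist_eq_norm]
      refine lt_of_le_of_lt (ContinuousLinearMap.opNorm_le_bound _ (half_pos hε).le
        fun f => ?_) (half_lt_self hε)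
      refine lp.norm_le_of_forall_le (by positivity) fun x => ?_
      have hs : ∀ y, T (lp.single ∞ y 1) x = p x y := by
        intro y
        rw [hT, tsum_eq_single y]
        · simp
        · intro z hz
          simp [hz]
      have hb : ∀ y, ‖f y‖ ≤ ‖f‖ := lp.norm_apply_le_norm ENNReal.top_ne_zero f
      have hpf : Summable fun y => p x y * f y := by
        refine Summable.of_norm_bounded ((hsum x).mul_right ‖f‖) fun y => ?_
        rw [norm_mul, Real.norm_of_nonneg (hpos x y)]
        exact mul_le_mul_of_nonneg_left (hb y) (hpos x y)
      have hev : (T - ∑ y ∈ A, (evL y).smulRight (T (lp.single ∞ y 1))) f x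
          = ∑' y, (if y ∈ A then 0 else p x y * f y) := by
        rw [tail_tsum hpf, ← hT, ← evL_apply x, ← evL_apply x]
        rw [sub_apply, map_sub, sum_apply, map_sum]
        congr 1
        refine Finset.sum_congr rfl fun y _ => ?_
        rw [ContinuousLinearMap.smulRight_apply, map_smul, evL_apply, evL_apply, hs,
          smul_eq_mul, mul_comm]
      rw [hev]
      have hle : ‖∑' y, (if y ∈ A then 0 else p x y * f y)‖
          ≤ (∑' y, (if y ∈ A then 0 else p x y)) * ‖f‖ := by
        refine tsum_of_norm_bounded ((tail_summable (hsum x) A).hasSum.mul_right ‖f‖) fun y => ?_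
        by_cases hy : y ∈ A
        · simp [hy]
        · simp only [hy, if_false]
          rw [norm_mul, Real.norm_of_nonneg (hpos x y)]
          exact mul_le_mul_of_nonneg_left (hb y) (hpos x y)
      exact hle.trans (mul_le_mul_of_nonneg_right (hA x).le (norm_nonneg _))
    rw [hcl.closure_eq] at this
    exact this
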